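/- arXiv:1607.00575 — 5 statements merged into one kernel-verified Lean document; each statement's English description precedes it below -/
import Mathlib

section
/- Let α ∈ (0,1), C₀ = (1−α)(a₁b₂ − a₂b₁) > 0, C₁ = A₁b₂ − A₂a₂, C₂ = A₁b₁ − A₂a₁, and let f(p̃) = α·log₂(1 + h·p̃/σ²) + (1−α)·[log₂(1 + (C₁ − α·b₂·p̃)/(σ²·C₀)) + log₂(1 + (α·b₁·p̃ − C₂)/(σ²·C₀))]. Set p̃_min = max{0, C₂/(α·b₁)} and p̃_max = min{B/(α·T_f) + E, C₁/(α·b₂)}, and assume p̃_min ≤ p̃_max. Suppose p̃₀ lies in the domain of f (all three log arguments positive) and satisfies f′(p̃₀) = 0. Then: (1) if p̃_min ≤ p̃₀ ≤ p̃_max, then p̃₀ maximizes f over the interval [p̃_min, p̃_max]; (2) if p̃₀ > p̃_max, then p̃_max maximizes f over [p̃_min, p̃_max]; (3) if p̃₀ < p̃_min, then p̃_min maximizes f over [p̃_min, p̃_max]. -/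
lemma aux_tangent (u c x y : ℝ) (hx : 0 < u + c * x) (hy : 0 < u + c * y) :
    Real.logb 2 (u + c * x) ≤ Real.logb 2 (u + c * y)
      + (c / ((u + c * y) * Real.log 2)) * (x - y) := by
  have hl : 0 < Real.log 2 := Real.log_pos (by norm_num)
  have h := Real.log_le_sub_one_of_pos (div_pos hx hy)
  rw [Real.log_div hx.ne' hy.ne'] at h
  have e : (u + c * x) / (u + c * y) - 1 = c / (u + c * y) * (x - y) := by
    field_simp
    ring
  rw [e] at h
  unfold Real.logb
  have e2 : Real.log (u + c * y) / Real.log 2 + (c / ((u + c * y) * Real.log 2)) * (x - y)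
      = (Real.log (u + c * y) + c / (u + c * y) * (x - y)) / Real.log 2 := by
    field_simp
  rw [e2]
  exact div_le_div_of_nonneg_right (by linarith) hl.le

lemma aux_concave (u c x y t s : ℝ) (hx : 0 < u + c * x) (hy : 0 < u + c * y)
    (ht : 0 ≤ t) (hs : 0 ≤ s) (hts : t + s = 1) :
    t * Real.logb 2 (u + c * x) + s * Real.logb 2 (u + c * y)
      ≤ Real.logb 2 (u + c * (t * x + s * y)) := by
  have hl : 0 < Real.log 2 := Real.log_pos (by norm_num)
  have h := strictConcaveOn_log_Ioi.concaveOn.2 hx hy ht hs hts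
  simp only [smul_eq_mul] at h
  have e : t * (u + c * x) + s * (u + c * y) = u + c * (t * x + s * y) := by
    have : s = 1 - t := by linarith
    subst this
    ring
  rw [e] at h
  unfold Real.logb
  rw [← mul_div_assoc, ← mul_div_assoc, ← add_div]
  exact div_le_div_of_nonneg_right h hl.le

lemma aux_deriv (u c y : ℝ) (hy : 0 < u + c * y) :
    HasDerivAt (fun x => Real.logb 2 (u + c * x)) (c / ((u + c * y) * Real.log 2)) y := by
  have h1 : HasDerivAt (fun x => u + c * x) c y := by
    simpa using ((hasDerivAt_id y).const_mul c).const_add u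
  have h2 := (h1.log hy.ne').div_const (Real.log 2)
  rw [div_div] at h2
  exact h2


/-- Let `f` be the per-frame sum-rate as a function of the
single-BS-phase power `p̃` (with the closed-form ZF-JT powers substituted), and let
`[p̃_min, p̃_max]` be the feasible interval.  If `p̃₀` is a stationary point of `f`
lying in the domain of `f`, then the maximizer of `f` over `[p̃_min, p̃_max]` is
`p̃₀` if `p̃_min ≤ p̃₀ ≤ p̃_max`, is `p̃_max` if `p̃₀ > p̃_max`, and is `p̃_min` if
`p̃₀ < p̃_min`. -/
theorem per_frame_rate_maximizer_cases
    (σ2 h a1 a2 b1 b2 A1 A2 B E Tf α C0 C1 C2 pmin pmax pt0 : ℝ)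
    (hσ2 : 0 < σ2) (hh : 0 < h)
    (ha1 : 0 < a1) (ha2 : 0 < a2) (hb1 : 0 < b1) (hb2 : 0 < b2)
    (hA1 : 0 ≤ A1) (hA2 : 0 ≤ A2) (hB : 0 ≤ B) (hE : 0 ≤ E) (hTf : 0 < Tf)
    (hα0 : 0 < α) (hα1 : α < 1)
    (hC0 : C0 = (1 - α) * (a1 * b2 - a2 * b1)) (hC0pos : 0 < C0)
    (hC1 : C1 = A1 * b2 - A2 * a2)
    (hC2 : C2 = A1 * b1 - A2 * a1)
    (f : ℝ → ℝ)
    (hf : f = fun pt =>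
      α * Real.logb 2 (1 + h * pt / σ2) +
      (1 - α) * (Real.logb 2 (1 + (C1 - α * b2 * pt) / (σ2 * C0)) +
                 Real.logb 2 (1 + (α * b1 * pt - C2) / (σ2 * C0))))
    (hpmin : pmin = max 0 (C2 / (α * b1)))
    (hpmax : pmax = min (B / (α * Tf) + E) (C1 / (α * b2)))
    (hfeas : pmin ≤ pmax)
    (hdom1 : 0 < 1 + h * pt0 / σ2)
    (hdom2 : 0 < 1 + (C1 - α * b2 * pt0) / (σ2 * C0))
    (hdom3 : 0 < 1 + (α * b1 * pt0 - C2) / (σ2 * C0))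
    (hstat : deriv f pt0 = 0) :
    ((pmin ≤ pt0 ∧ pt0 ≤ pmax) → ∀ x ∈ Set.Icc pmin pmax, f x ≤ f pt0) ∧
    (pmax < pt0 → ∀ x ∈ Set.Icc pmin pmax, f x ≤ f pmax) ∧
    (pt0 < pmin → ∀ x ∈ Set.Icc pmin pmax, f x ≤ f pmin) := by
  have hK : 0 < σ2 * C0 := mul_pos hσ2 hC0pos
  have e1 : ∀ x : ℝ, 1 + h * x / σ2 = 1 + (h / σ2) * x := fun x => by ring
  have e2 : ∀ x : ℝ, 1 + (C1 - α * b2 * x) / (σ2 * C0)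
      = (1 + C1 / (σ2 * C0)) + (-(α * b2) / (σ2 * C0)) * x := fun x => by ring
  have e3 : ∀ x : ℝ, 1 + (α * b1 * x - C2) / (σ2 * C0)
      = (1 - C2 / (σ2 * C0)) + ((α * b1) / (σ2 * C0)) * x := fun x => by ring
  have dom : ∀ x ∈ Set.Icc pmin pmax, 0 < 1 + h * x / σ2 ∧
      0 < 1 + (C1 - α * b2 * x) / (σ2 * C0) ∧ 0 < 1 + (α * b1 * x - C2) / (σ2 * C0) := by
    intro x hx
    have hx0 : 0 ≤ x := le_trans (by rw [hpmin]; exact le_max_left _ _) hx.1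
    have hx1 : C2 / (α * b1) ≤ x := le_trans (by rw [hpmin]; exact le_max_right _ _) hx.1
    have hx2 : x ≤ C1 / (α * b2) := le_trans hx.2 (by rw [hpmax]; exact min_le_right _ _)
    rw [div_le_iff₀ (by positivity)] at hx1
    rw [le_div_iff₀ (by positivity)] at hx2
    have h2 : 0 ≤ (C1 - α * b2 * x) / (σ2 * C0) := div_nonneg (by linarith) hK.le
    have h3 : 0 ≤ (α * b1 * x - C2) / (σ2 * C0) := div_nonneg (by linarith) hK.le
    exact ⟨by positivity, by linarith, by linarith⟩
  simp only [e1, e2, e3] at hf dom hdom1 hdom2 hdom3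
  generalize h / σ2 = c1 at *
  generalize 1 + C1 / (σ2 * C0) = u2 at *
  generalize -(α * b2) / (σ2 * C0) = c2 at *
  generalize 1 - C2 / (σ2 * C0) = u3 at *
  generalize (α * b1) / (σ2 * C0) = c3 at *
  have hd := ((aux_deriv 1 c1 pt0 hdom1).const_mul α).add
    (((aux_deriv u2 c2 pt0 hdom2).add (aux_deriv u3 c3 pt0 hdom3)).const_mul (1 - α))
  have hd' : deriv f pt0 = α * (c1 / ((1 + c1 * pt0) * Real.log 2)) +
      (1 - α) * (c2 / ((u2 + c2 * pt0) * Real.log 2)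
        + c3 / ((u3 + c3 * pt0) * Real.log 2)) := by
    rw [hf]
    exact hd.deriv
  rw [hstat] at hd'
  have hβ : 0 < 1 - α := by linarith
  have glob : ∀ x ∈ Set.Icc pmin pmax, f x ≤ f pt0 := by
    intro x hx
    obtain ⟨d1, d2, d3⟩ := dom x hx
    have t1 := mul_le_mul_of_nonneg_left (aux_tangent 1 c1 x pt0 d1 hdom1) hα0.le
    have t2 := mul_le_mul_of_nonneg_left (aux_tangent u2 c2 x pt0 d2 hdom2) hβ.le
    have t3 := mul_le_mul_of_nonneg_left (aux_tangent u3 c3 x pt0 d3 hdom3) hβ.le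
    have z := congrArg (fun w => w * (x - pt0)) hd'
    simp only [hf]
    simp only [zero_mul] at z
    linarith
  have conc : ∀ x ∈ Set.Icc pmin pmax, ∀ t s : ℝ, 0 ≤ t → 0 ≤ s → t + s = 1 →
      f x ≤ f (t * x + s * pt0) := by
    intro x hx t s ht hs hts
    obtain ⟨d1, d2, d3⟩ := dom x hx
    have t1 := mul_le_mul_of_nonneg_left (aux_concave 1 c1 x pt0 t s d1 hdom1 ht hs hts) hα0.le
    have t2 := mul_le_mul_of_nonneg_left (aux_concave u2 c2 x pt0 t s d2 hdom2 ht hs hts) hβ.le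
    have t3 := mul_le_mul_of_nonneg_left (aux_concave u3 c3 x pt0 t s d3 hdom3 ht hs hts) hβ.le
    have g := mul_le_mul_of_nonneg_left (glob x hx) hs
    have k : t * f x + s * f pt0 ≤ f (t * x + s * pt0) := by
      simp only [hf]
      linarith
    have k2 : t * f x + s * f x = f x := by rw [← add_mul, hts, one_mul]
    linarith
  refine ⟨fun _ => glob, fun hlt x hx => ?_, fun hlt x hx => ?_⟩
  · have hpos : 0 < pt0 - x := by linarith [hx.2]
    have := conc x hx ((pt0 - pmax) / (pt0 - x)) ((pmax - x) / (pt0 - x))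
      (div_nonneg (by linarith) hpos.le) (div_nonneg (by linarith [hx.2]) hpos.le)
      (by field_simp; ring)
    have e : (pt0 - pmax) / (pt0 - x) * x + (pmax - x) / (pt0 - x) * pt0 = pmax := by
      field_simp
      ring
    rwa [e] at this
  · have hpos : 0 < x - pt0 := by linarith [hx.1]
    have := conc x hx ((pmin - pt0) / (x - pt0)) ((x - pmin) / (x - pt0))
      (div_nonneg (by linarith) hpos.le) (div_nonneg (by linarith [hx.1]) hpos.le)
      (by field_simp; ring)
    have e : (pmin - pt0) / (x - pt0) * x + (x - pmin) / (x - pt0) * pt0 = pmin := by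
      field_simp
      ring
    rwa [e] at this
end

section
/- Define F : [0,1] → ℝ so that F(α) is the maximum of R(α,p̃,p₁,p₂) = α·log₂(1+h·p̃/σ²) + (1−α)·[log₂(1+p₁/σ²)+log₂(1+p₂/σ²)] over the feasible set F_α = {(p̃,p₁,p₂) : p̃,p₁,p₂ ≥ 0, α·p̃ ≤ B/T_f + α·E, (1−α)(a₁p₁+a₂p₂) + α·p̃ ≤ A₁, (1−α)(b₁p₁+b₂p₂) ≤ A₂}. Let α¹, α² ∈ [0,1], γ ∈ (0,1), and α′ = γα¹ + (1−γ)α² with 0 < α′ < 1. If the maximum F(α^j) is attained at some feasible point (p̃^(j), p₁^(j), p₂^(j)) ∈ F_{α^j} for j = 1,2, and F(α′) is attained over F_{α′}, then γ·F(α¹) + (1−γ)·F(α²) ≤ F(γα¹ + (1−γ)α²); i.e., F is (midpoint-)concave at such combinations. -/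
/-- Weighted Jensen inequality for the logarithmic rate, via the tangent line. -/
theorem rate_jensen (c u v s x y q : ℝ) (hc : 0 ≤ c) (hu : 0 ≤ u) (hv : 0 ≤ v)
    (hs : u + v = s) (hx : 0 ≤ x) (hy : 0 ≤ y) (hq : 0 ≤ q)
    (h : s * q = u * x + v * y) :
    u * Real.logb 2 (1 + c * x) + v * Real.logb 2 (1 + c * y)
      ≤ s * Real.logb 2 (1 + c * q) := by
  have hQ : 0 < 1 + c * q := by positivity
  have tang : ∀ z, 0 ≤ z →
      Real.log (1 + c * z) ≤ Real.log (1 + c * q) + ((1 + c * z) / (1 + c * q) - 1) := by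
    intro z hz
    have hZ : 0 < 1 + c * z := by positivity
    have h1 := Real.log_le_sub_one_of_pos (div_pos hZ hQ)
    rw [Real.log_div hZ.ne' hQ.ne'] at h1
    linarith
  have e1 := mul_le_mul_of_nonneg_left (tang x hx) hu
  have e2 := mul_le_mul_of_nonneg_left (tang y hy) hv
  have e3 : u * ((1 + c * x) / (1 + c * q) - 1) + v * ((1 + c * y) / (1 + c * q) - 1) = 0 := by
    field_simp
    subst hs
    linear_combination (-c) * h
  have key : u * Real.log (1 + c * x) + v * Real.log (1 + c * y)
      ≤ s * Real.log (1 + c * q) := by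
    subst hs
    linarith
  have h2 : 0 < Real.log 2 := Real.log_pos (by norm_num)
  have := div_le_div_of_nonneg_right key h2.le
  simp only [Real.logb]
  calc _ = (u * Real.log (1 + c * x) + v * Real.log (1 + c * y)) / Real.log 2 := by ring
    _ ≤ _ := this
    _ = _ := by ring

/-- Let `F(α)` be the maximal per-frame sum-rate over the feasible set
`F_α` (with inequality budget constraints).  If the maxima at `α¹`, `α²`, and at the
convex combination `α′ = γα¹ + (1−γ)α² ∈ (0,1)` are attained, then
`γ·F(α¹) + (1−γ)·F(α²) ≤ F(α′)`, i.e. `F` is concave at such combinations. -/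
theorem optimal_rate_concave_in_alpha
    (σ2 h a1 a2 b1 b2 A1 A2 B E Tf : ℝ)
    (hσ2 : 0 < σ2) (hh : 0 < h)
    (ha1 : 0 < a1) (ha2 : 0 < a2) (hb1 : 0 < b1) (hb2 : 0 < b2)
    (hA1 : 0 ≤ A1) (hA2 : 0 ≤ A2) (hB : 0 ≤ B) (hE : 0 ≤ E) (hTf : 0 < Tf)
    (V : ℝ → Set ℝ)
    (hV : V = fun α => {r : ℝ | ∃ pt p1 p2 : ℝ,
      0 ≤ pt ∧ 0 ≤ p1 ∧ 0 ≤ p2 ∧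
      α * pt ≤ B / Tf + α * E ∧
      (1 - α) * (a1 * p1 + a2 * p2) + α * pt ≤ A1 ∧
      (1 - α) * (b1 * p1 + b2 * p2) ≤ A2 ∧
      r = α * Real.logb 2 (1 + h * pt / σ2) +
          (1 - α) * (Real.logb 2 (1 + p1 / σ2) + Real.logb 2 (1 + p2 / σ2))})
    (α1 α2 γ F1 F2 F' : ℝ)
    (hα1 : α1 ∈ Set.Icc (0 : ℝ) 1) (hα2 : α2 ∈ Set.Icc (0 : ℝ) 1)
    (hγ : γ ∈ Set.Ioo (0 : ℝ) 1)
    (hα' : γ * α1 + (1 - γ) * α2 ∈ Set.Ioo (0 : ℝ) 1)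
    (hF1 : IsGreatest (V α1) F1)
    (hF2 : IsGreatest (V α2) F2)
    (hF' : IsGreatest (V (γ * α1 + (1 - γ) * α2)) F') :
    γ * F1 + (1 - γ) * F2 ≤ F' := by
  subst hV
  obtain ⟨⟨x, x1, x2, hx, hx1, hx2, cx1, cx2, cx3, rfl⟩, -⟩ := hF1
  obtain ⟨⟨y, y1, y2, hy, hy1, hy2, cy1, cy2, cy3, rfl⟩, -⟩ := hF2
  obtain ⟨hγ0, hγ1⟩ := hγ
  obtain ⟨hs0, hs1⟩ := hα'
  have hg : 0 < 1 - γ := by linarith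
  have hu : 0 ≤ γ * α1 := mul_nonneg hγ0.le hα1.1
  have hv : 0 ≤ (1 - γ) * α2 := mul_nonneg hg.le hα2.1
  have hu' : 0 ≤ γ * (1 - α1) := mul_nonneg hγ0.le (by linarith [hα1.2])
  have hv' : 0 ≤ (1 - γ) * (1 - α2) := mul_nonneg hg.le (by linarith [hα2.2])
  obtain ⟨s, hs⟩ : ∃ s, s = γ * α1 + (1 - γ) * α2 := ⟨_, rfl⟩
  rw [← hs] at hF' hs0 hs1
  have ht0 : 0 < 1 - s := by linarith
  have ht : γ * (1 - α1) + (1 - γ) * (1 - α2) = 1 - s := by rw [hs]; ring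
  obtain ⟨q, hq, eq⟩ : ∃ q, 0 ≤ q ∧ s * q = γ * α1 * x + (1 - γ) * α2 * y :=
    ⟨(γ * α1 * x + (1 - γ) * α2 * y) / s, by positivity, by field_simp⟩
  obtain ⟨q1, hq1, eq1⟩ : ∃ q, 0 ≤ q ∧
      (1 - s) * q = γ * (1 - α1) * x1 + (1 - γ) * (1 - α2) * y1 :=
    ⟨(γ * (1 - α1) * x1 + (1 - γ) * (1 - α2) * y1) / (1 - s),
      div_nonneg (add_nonneg (mul_nonneg hu' hx1) (mul_nonneg hv' hy1)) ht0.le,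
      mul_div_cancel₀ _ ht0.ne'⟩
  obtain ⟨q2, hq2, eq2⟩ : ∃ q, 0 ≤ q ∧
      (1 - s) * q = γ * (1 - α1) * x2 + (1 - γ) * (1 - α2) * y2 :=
    ⟨(γ * (1 - α1) * x2 + (1 - γ) * (1 - α2) * y2) / (1 - s),
      div_nonneg (add_nonneg (mul_nonneg hu' hx2) (mul_nonneg hv' hy2)) ht0.le,
      mul_div_cancel₀ _ ht0.ne'⟩
  have j := rate_jensen (h / σ2) _ _ s x y q (by positivity) hu hv hs.symm hx hy hq eq
  have j1 := rate_jensen (1 / σ2) _ _ _ x1 y1 q1 (by positivity) hu' hv' ht hx1 hy1 hq1 eq1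
  have j2 := rate_jensen (1 / σ2) _ _ _ x2 y2 q2 (by positivity) hu' hv' ht hx2 hy2 hq2 eq2
  have r : ∀ z, h / σ2 * z = h * z / σ2 := fun z => by ring
  have r1 : ∀ z, 1 / σ2 * z = z / σ2 := fun z => by ring
  simp only [r] at j
  simp only [r1] at j1 j2
  have comb : ∀ {l l' m m' : ℝ}, l ≤ m → l' ≤ m' →
      γ * l + (1 - γ) * l' ≤ γ * m + (1 - γ) * m' := fun h1 h2 =>
    add_le_add (mul_le_mul_of_nonneg_left h1 hγ0.le) (mul_le_mul_of_nonneg_left h2 hg.le)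
  have hmem := hF'.2 ⟨q, q1, q2, hq, hq1, hq2, ?_, ?_, ?_, rfl⟩
  · refine le_trans ?_ hmem
    linarith
  · have := comb cx1 cy1
    rw [eq, hs]
    linarith
  · have := comb cx2 cy2
    have e : (1 - s) * (a1 * q1 + a2 * q2) + s * q
        = a1 * ((1 - s) * q1) + a2 * ((1 - s) * q2) + s * q := by ring
    rw [e, eq, eq1, eq2]
    linarith
  · have := comb cx3 cy3
    have e : (1 - s) * (b1 * q1 + b2 * q2)
        = b1 * ((1 - s) * q1) + b2 * ((1 - s) * q2) := by ring
    rw [e, eq1, eq2]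
    linarith
end

section
/- Define F̄ : [0,1] → ℝ so that F̄(α) is the maximum of R(α,p̃,p₁,p₂) = α·log₂(1+h·p̃/σ²) + (1−α)·[log₂(1+p₁/σ²)+log₂(1+p₂/σ²)] over the set F̄_α = {(p̃,p₁,p₂) : p̃,p₁,p₂ ≥ 0, α·p̃ ≤ B/T_f + α·E, (1−α)(a₁p₁+a₂p₂) + α·p̃ = A₁, (1−α)(b₁p₁+b₂p₂) = A₂}, i.e., with the two budget constraints imposed as equalities. Let α¹, α² ∈ [0,1], γ ∈ (0,1), and α′ = γα¹ + (1−γ)α² with 0 < α′ < 1. If F̄(α¹), F̄(α²), and F̄(α′) are all attained by feasible points, then γ·F̄(α¹) + (1−γ)·F̄(α²) ≤ F̄(γα¹ + (1−γ)α²); i.e., F̄ is concave on its feasible range. -/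
theorem logb_perspective (u v X Y : ℝ) (hu : 0 ≤ u) (hv : 0 ≤ v) (huv : 0 < u + v)
    (hX : 0 < X) (hY : 0 < Y) :
    u * Real.logb 2 X + v * Real.logb 2 Y ≤ (u + v) * Real.logb 2 ((u * X + v * Y) / (u + v)) := by
  have hc := strictConcaveOn_log_Ioi.concaveOn.2 (Set.mem_Ioi.2 hX) (Set.mem_Ioi.2 hY)
    (div_nonneg hu huv.le) (div_nonneg hv huv.le) (by field_simp)
  simp only [smul_eq_mul] at hc
  have e : u / (u + v) * X + v / (u + v) * Y = (u * X + v * Y) / (u + v) := by ring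
  rw [e] at hc
  have h2 : 0 < Real.log 2 := Real.log_pos (by norm_num)
  have h3 := mul_le_mul_of_nonneg_left hc huv.le
  have e2 : (u + v) * (u / (u + v) * Real.log X + v / (u + v) * Real.log Y)
      = u * Real.log X + v * Real.log Y := by field_simp
  rw [e2] at h3
  have h4 := div_le_div_of_nonneg_right h3 h2.le
  unfold Real.logb
  calc _ = (u * Real.log X + v * Real.log Y) / Real.log 2 := by ring
    _ ≤ _ := h4
    _ = _ := by ring

theorem logb_perspective_affine (u v w c x y : ℝ) (hu : 0 ≤ u) (hv : 0 ≤ v) (hw : w = u + v)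
    (huv : 0 < w) (hc : 0 ≤ c) (hx : 0 ≤ x) (hy : 0 ≤ y) :
    u * Real.logb 2 (1 + c * x) + v * Real.logb 2 (1 + c * y)
      ≤ w * Real.logb 2 (1 + c * ((u * x + v * y) / w)) := by
  subst hw
  have := logb_perspective u v (1 + c * x) (1 + c * y) hu hv huv (by positivity) (by positivity)
  have e : (u * (1 + c * x) + v * (1 + c * y)) / (u + v)
      = 1 + c * ((u * x + v * y) / (u + v)) := by field_simp; ring
  rwa [e] at this

/-- Let `F̄(α)` be the maximal per-frame sum-rate over the feasible set
`F̄_α` in which both per-BS power-budget constraints hold with equality.  If the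
maxima at `α¹`, `α²`, and at the convex combination `α′ = γα¹ + (1−γ)α² ∈ (0,1)` are
attained, then `γ·F̄(α¹) + (1−γ)·F̄(α²) ≤ F̄(α′)`, i.e. `F̄` is concave on its
feasible range. -/
theorem optimal_rate_equality_constraints_concave_in_alpha
    (σ2 h a1 a2 b1 b2 A1 A2 B E Tf : ℝ)
    (hσ2 : 0 < σ2) (hh : 0 < h)
    (ha1 : 0 < a1) (ha2 : 0 < a2) (hb1 : 0 < b1) (hb2 : 0 < b2)
    (hA1 : 0 ≤ A1) (hA2 : 0 ≤ A2) (hB : 0 ≤ B) (hE : 0 ≤ E) (hTf : 0 < Tf)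
    (V : ℝ → Set ℝ)
    (hV : V = fun α => {r : ℝ | ∃ pt p1 p2 : ℝ,
      0 ≤ pt ∧ 0 ≤ p1 ∧ 0 ≤ p2 ∧
      α * pt ≤ B / Tf + α * E ∧
      (1 - α) * (a1 * p1 + a2 * p2) + α * pt = A1 ∧
      (1 - α) * (b1 * p1 + b2 * p2) = A2 ∧
      r = α * Real.logb 2 (1 + h * pt / σ2) +
          (1 - α) * (Real.logb 2 (1 + p1 / σ2) + Real.logb 2 (1 + p2 / σ2))})
    (α1 α2 γ F1 F2 F' : ℝ)
    (hα1 : α1 ∈ Set.Icc (0 : ℝ) 1) (hα2 : α2 ∈ Set.Icc (0 : ℝ) 1)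
    (hγ : γ ∈ Set.Ioo (0 : ℝ) 1)
    (hα' : γ * α1 + (1 - γ) * α2 ∈ Set.Ioo (0 : ℝ) 1)
    (hF1 : IsGreatest (V α1) F1)
    (hF2 : IsGreatest (V α2) F2)
    (hF' : IsGreatest (V (γ * α1 + (1 - γ) * α2)) F') :
    γ * F1 + (1 - γ) * F2 ≤ F' := by
  subst hV
  obtain ⟨⟨x, p1, p2, hx, hp1, hp2, c1, c2, c3, rfl⟩, -⟩ := hF1
  obtain ⟨⟨y, q1, q2, hy, hq1, hq2, d1, d2, d3, rfl⟩, -⟩ := hF2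
  obtain ⟨hα10, hα11⟩ := hα1
  obtain ⟨hα20, hα21⟩ := hα2
  obtain ⟨hγ0, hγ1⟩ := hγ
  obtain ⟨hw0, hw1⟩ := hα'
  have hmax := hF'.2
  clear hF'
  have hg : 0 < 1 - γ := by linarith
  have u1 : 0 ≤ γ * α1 := by positivity
  have v1 : 0 ≤ (1 - γ) * α2 := by positivity
  have u2 : 0 ≤ γ * (1 - α1) := mul_nonneg hγ0.le (by linarith)
  have v2 : 0 ≤ (1 - γ) * (1 - α2) := mul_nonneg hg.le (by linarith)
  generalize hw : γ * α1 + (1 - γ) * α2 = w at *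
  have hz : 0 < 1 - w := by linarith
  have hzz : 1 - w = γ * (1 - α1) + (1 - γ) * (1 - α2) := by rw [← hw]; ring
  have k0 := logb_perspective_affine _ _ w (h / σ2) x y u1 v1 hw.symm hw0 (by positivity) hx hy
  have k1 := logb_perspective_affine _ _ (1 - w) (1 / σ2) p1 q1 u2 v2 hzz hz (by positivity) hp1 hq1
  have k2 := logb_perspective_affine _ _ (1 - w) (1 / σ2) p2 q2 u2 v2 hzz hz (by positivity) hp2 hq2
  have m0 : 0 ≤ (γ * α1 * x + (1 - γ) * α2 * y) / w := by positivity
  have m1 : 0 ≤ (γ * (1 - α1) * p1 + (1 - γ) * (1 - α2) * q1) / (1 - w) := by positivity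
  have m2 : 0 ≤ (γ * (1 - α1) * p2 + (1 - γ) * (1 - α2) * q2) / (1 - w) := by positivity
  have t0 : w * ((γ * α1 * x + (1 - γ) * α2 * y) / w) = γ * α1 * x + (1 - γ) * α2 * y := by
    field_simp
  have t1 : (1 - w) * ((γ * (1 - α1) * p1 + (1 - γ) * (1 - α2) * q1) / (1 - w))
      = γ * (1 - α1) * p1 + (1 - γ) * (1 - α2) * q1 := mul_div_cancel₀ _ hz.ne'
  have t2 : (1 - w) * ((γ * (1 - α1) * p2 + (1 - γ) * (1 - α2) * q2) / (1 - w))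
      = γ * (1 - α1) * p2 + (1 - γ) * (1 - α2) * q2 := mul_div_cancel₀ _ hz.ne'
  generalize (γ * α1 * x + (1 - γ) * α2 * y) / w = z at *
  generalize (γ * (1 - α1) * p1 + (1 - γ) * (1 - α2) * q1) / (1 - w) = r1 at *
  generalize (γ * (1 - α1) * p2 + (1 - γ) * (1 - α2) * q2) / (1 - w) = r2 at *
  have key := hmax (show _ ∈ _ from ⟨z, r1, r2, m0, m1, m2, ?_, ?_, ?_, rfl⟩)
  · refine le_trans ?_ key
    have e1 : ∀ s : ℝ, 1 / σ2 * s = s / σ2 := fun s => by ring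
    have e2 : ∀ s : ℝ, h / σ2 * s = h * s / σ2 := fun s => by ring
    simp only [e1, e2] at k0 k1 k2
    linarith
  · have f1 := mul_le_mul_of_nonneg_left c1 hγ0.le
    have f2 := mul_le_mul_of_nonneg_left d1 hg.le
    rw [t0, ← hw]
    linarith
  · linear_combination t0 + a1 * t1 + a2 * t2 + γ * c2 + (1 - γ) * d2
  · linear_combination b1 * t1 + b2 * t2 + γ * c3 + (1 - γ) * d3
end

section
/- Let α¹, α² ∈ [0,1] and, for j = 1,2, let (p̃^(j), p₁^(j), p₂^(j)) satisfy the feasibility constraints (C1)–(C4) with parameter α^(j): p̃^(j), p₁^(j), p₂^(j) ≥ 0, α^(j)·p̃^(j) ≤ B/T_f + α^(j)·E, (1−α^(j))(a₁p₁^(j)+a₂p₂^(j)) + α^(j)·p̃^(j) ≤ A₁, (1−α^(j))(b₁p₁^(j)+b₂p₂^(j)) ≤ A₂. Let γ ∈ [0,1], α′ = γα¹ + (1−γ)α², and assume 0 < α′ < 1. Define p̃′ = (γα¹·p̃^(1) + (1−γ)α²·p̃^(2))/α′ and pᵢ′ = (γ(1−α¹)·pᵢ^(1) + (1−γ)(1−α²)·pᵢ^(2))/(1−α′)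 for i = 1,2. Then (p̃′, p₁′, p₂′) satisfies the feasibility constraints (C1)–(C4) with parameter α′. -/
/-- Feasibility is preserved under the convex combination used in the
concavity proof of the optimal per-frame sum-rate in `α`: if `(p̃⁽ʲ⁾,p₁⁽ʲ⁾,p₂⁽ʲ⁾)`
is feasible for `α⁽ʲ⁾` (j = 1,2), then the rescaled combined point
`(p̃′,p₁′,p₂′)` is feasible for `α′ = γα¹ + (1−γ)α² ∈ (0,1)`. -/
theorem convex_combination_preserves_feasibility
    (a1 a2 b1 b2 A1 A2 B E Tf : ℝ)
    (ha1 : 0 < a1) (ha2 : 0 < a2) (hb1 : 0 < b1) (hb2 : 0 < b2)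
    (hA1 : 0 ≤ A1) (hA2 : 0 ≤ A2) (hB : 0 ≤ B) (hE : 0 ≤ E) (hTf : 0 < Tf)
    (α1 α2 γ pt1 p11 p21 pt2 p12 p22 α' pt' p1' p2' : ℝ)
    (hα1 : α1 ∈ Set.Icc (0 : ℝ) 1) (hα2 : α2 ∈ Set.Icc (0 : ℝ) 1)
    (hγ : γ ∈ Set.Icc (0 : ℝ) 1)
    (hpt1 : 0 ≤ pt1) (hp11 : 0 ≤ p11) (hp21 : 0 ≤ p21)
    (hpt2 : 0 ≤ pt2) (hp12 : 0 ≤ p12) (hp22 : 0 ≤ p22)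
    (hC1a : α1 * pt1 ≤ B / Tf + α1 * E)
    (hC2a : (1 - α1) * (a1 * p11 + a2 * p21) + α1 * pt1 ≤ A1)
    (hC3a : (1 - α1) * (b1 * p11 + b2 * p21) ≤ A2)
    (hC1b : α2 * pt2 ≤ B / Tf + α2 * E)
    (hC2b : (1 - α2) * (a1 * p12 + a2 * p22) + α2 * pt2 ≤ A1)
    (hC3b : (1 - α2) * (b1 * p12 + b2 * p22) ≤ A2)
    (hα' : α' = γ * α1 + (1 - γ) * α2)
    (hα'0 : 0 < α') (hα'1 : α' < 1)
    (hpt' : pt' = (γ * α1 * pt1 + (1 - γ) * α2 * pt2) / α')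
    (hp1' : p1' = (γ * (1 - α1) * p11 + (1 - γ) * (1 - α2) * p12) / (1 - α'))
    (hp2' : p2' = (γ * (1 - α1) * p21 + (1 - γ) * (1 - α2) * p22) / (1 - α')) :
    0 ≤ pt' ∧ 0 ≤ p1' ∧ 0 ≤ p2' ∧
    α' * pt' ≤ B / Tf + α' * E ∧
    (1 - α') * (a1 * p1' + a2 * p2') + α' * pt' ≤ A1 ∧
    (1 - α') * (b1 * p1' + b2 * p2') ≤ A2 := by
  obtain ⟨h10, h11⟩ := hα1
  obtain ⟨h20, h21⟩ := hα2
  obtain ⟨hg0, hg1⟩ := hγ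
  have k1 : 0 ≤ 1 - α1 := by linarith
  have k2 : 0 ≤ 1 - α2 := by linarith
  have kg : 0 ≤ 1 - γ := by linarith
  have ka : 0 < 1 - α' := by linarith
  have et : α' * pt' = γ * α1 * pt1 + (1 - γ) * α2 * pt2 := by
    rw [hpt']; exact mul_div_cancel₀ _ hα'0.ne'
  have e1 : (1 - α') * p1' = γ * (1 - α1) * p11 + (1 - γ) * (1 - α2) * p12 := by
    rw [hp1']; exact mul_div_cancel₀ _ ka.ne'
  have e2 : (1 - α') * p2' = γ * (1 - α1) * p21 + (1 - γ) * (1 - α2) * p22 := by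
    rw [hp2']; exact mul_div_cancel₀ _ ka.ne'
  have split : ∀ c d : ℝ, (1 - α') * (c * p1' + d * p2') =
      γ * ((1 - α1) * (c * p11 + d * p21)) + (1 - γ) * ((1 - α2) * (c * p12 + d * p22)) := by
    intro c d
    linear_combination c * e1 + d * e2
  refine ⟨?_, ?_, ?_, ?_, ?_, ?_⟩
  · rw [hpt']; positivity
  · rw [hp1']; positivity
  · rw [hp2']; positivity
  · rw [et, hα']
    linarith [mul_le_mul_of_nonneg_left hC1a hg0, mul_le_mul_of_nonneg_left hC1b kg]
  · rw [et, split]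
    linarith [mul_le_mul_of_nonneg_left hC2a hg0, mul_le_mul_of_nonneg_left hC2b kg]
  · rw [split]
    linarith [mul_le_mul_of_nonneg_left hC3a hg0, mul_le_mul_of_nonneg_left hC3b kg]
end

section
/- Let α¹, α² ∈ [0,1], γ ∈ [0,1], α′ = γα¹ + (1−γ)α² with 0 < α′ < 1, and let p̃^(1), p̃^(2), p₁^(1), p₂^(1), p₁^(2), p₂^(2) ≥ 0. Define p̃′ = (γα¹·p̃^(1) + (1−γ)α²·p̃^(2))/α′ and pᵢ′ = (γ(1−α¹)·pᵢ^(1) + (1−γ)(1−α²)·pᵢ^(2))/(1−α′) for i = 1,2. Then γ·[α¹·log₂(1+h·p̃^(1)/σ²) + (1−α¹)·Σ_{i=1}^{2} log₂(1+pᵢ^(1)/σ²)] + (1−γ)·[α²·log₂(1+h·p̃^(2)/σ²) + (1−α²)·Σ_{i=1}^{2} log₂(1+pᵢ^(2)/σ²)] ≤ α′·log₂(1+h·p̃′/σ²) + (1−α′)·Σ_{i=1}^{2} log₂(1+pᵢ′/σ²). -/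
/-- Weighted two-point Jensen inequality for `logb 2 (1 + k x / s)`. -/
theorem jensen_logb_aux (s k a b c x y z : ℝ) (hs : 0 < s) (hk : 0 < k)
    (ha : 0 ≤ a) (hb : 0 ≤ b) (hc : 0 < c) (hab : c = a + b)
    (hx : 0 ≤ x) (hy : 0 ≤ y) (hz : z = (a * x + b * y) / c) :
    a * Real.logb 2 (1 + k * x / s) + b * Real.logb 2 (1 + k * y / s)
      ≤ c * Real.logb 2 (1 + k * z / s) := by
  have hX : 0 < 1 + k * x / s := by positivity
  have hY : 0 < 1 + k * y / s := by positivity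
  have hsum : a / c + b / c = 1 := by
    rw [← add_div, ← hab, div_self hc.ne']
  have key := strictConcaveOn_log_Ioi.concaveOn.2 (Set.mem_Ioi.2 hX) (Set.mem_Ioi.2 hY)
    (div_nonneg ha hc.le) (div_nonneg hb hc.le) hsum
  simp only [smul_eq_mul] at key
  have harg : a / c * (1 + k * x / s) + b / c * (1 + k * y / s) = 1 + k * z / s := by
    have e : a / c * (1 + k * x / s) + b / c * (1 + k * y / s)
        = (a / c + b / c) + k * ((a * x + b * y) / c) / s := by ring
    rw [e, hsum, hz]
  rw [harg] at key
  have h2 : 0 < Real.log 2 := Real.log_pos (by norm_num)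
  have key2 := mul_le_mul_of_nonneg_left key hc.le
  have e2 : c * (a / c * Real.log (1 + k * x / s) + b / c * Real.log (1 + k * y / s))
      = a * Real.log (1 + k * x / s) + b * Real.log (1 + k * y / s) := by
    field_simp
  rw [e2] at key2
  have key3 := div_le_div_of_nonneg_right key2 h2.le
  simp only [Real.logb]
  calc _ = _ := by ring
    _ ≤ _ := key3
    _ = _ := by ring

/-- Jensen-type inequality from concavity of the logarithm: the convex
combination of two per-frame sum-rate values is at most the sum-rate of the combined
time-split `α′` with the rescaled combined powers `p̃′, p₁′, p₂′`. -/
theorem sum_rate_jensen_inequality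
    (σ2 h : ℝ) (hσ2 : 0 < σ2) (hh : 0 < h)
    (α1 α2 γ α' pt1 pt2 p11 p21 p12 p22 pt' p1' p2' : ℝ)
    (hα1 : α1 ∈ Set.Icc (0 : ℝ) 1) (hα2 : α2 ∈ Set.Icc (0 : ℝ) 1)
    (hγ : γ ∈ Set.Icc (0 : ℝ) 1)
    (hα' : α' = γ * α1 + (1 - γ) * α2)
    (hα'0 : 0 < α') (hα'1 : α' < 1)
    (hpt1 : 0 ≤ pt1) (hpt2 : 0 ≤ pt2)
    (hp11 : 0 ≤ p11) (hp21 : 0 ≤ p21) (hp12 : 0 ≤ p12) (hp22 : 0 ≤ p22)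
    (hpt' : pt' = (γ * α1 * pt1 + (1 - γ) * α2 * pt2) / α')
    (hp1' : p1' = (γ * (1 - α1) * p11 + (1 - γ) * (1 - α2) * p12) / (1 - α'))
    (hp2' : p2' = (γ * (1 - α1) * p21 + (1 - γ) * (1 - α2) * p22) / (1 - α')) :
    γ * (α1 * Real.logb 2 (1 + h * pt1 / σ2) +
         (1 - α1) * (Real.logb 2 (1 + p11 / σ2) + Real.logb 2 (1 + p21 / σ2))) +
    (1 - γ) * (α2 * Real.logb 2 (1 + h * pt2 / σ2) +
         (1 - α2) * (Real.logb 2 (1 + p12 / σ2) + Real.logb 2 (1 + p22 / σ2)))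
    ≤ α' * Real.logb 2 (1 + h * pt' / σ2) +
      (1 - α') * (Real.logb 2 (1 + p1' / σ2) + Real.logb 2 (1 + p2' / σ2)) := by
  obtain ⟨a0, a1⟩ := hα1
  obtain ⟨b0, b1⟩ := hα2
  obtain ⟨g0, g1⟩ := hγ
  have g1' : 0 ≤ 1 - γ := by linarith
  have a1' : 0 ≤ 1 - α1 := by linarith
  have b1' : 0 ≤ 1 - α2 := by linarith
  have hc : 0 < 1 - α' := by linarith
  have hs : 1 - α' = γ * (1 - α1) + (1 - γ) * (1 - α2) := by rw [hα']; ring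
  have J0 := jensen_logb_aux σ2 h _ _ _ pt1 pt2 pt' hσ2 hh (mul_nonneg g0 a0)
    (mul_nonneg g1' b0) hα'0 hα' hpt1 hpt2 hpt'
  have J1 := jensen_logb_aux σ2 1 _ _ _ p11 p12 p1' hσ2 one_pos (mul_nonneg g0 a1')
    (mul_nonneg g1' b1') hc hs hp11 hp12 hp1'
  have J2 := jensen_logb_aux σ2 1 _ _ _ p21 p22 p2' hσ2 one_pos (mul_nonneg g0 a1')
    (mul_nonneg g1' b1') hc hs hp21 hp22 hp2'
  simp only [one_mul] at J1 J2
  calc _ = _ := by ring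
    _ ≤ _ := add_le_add J0 (add_le_add J1 J2)
    _ = _ := by ring
end
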